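/- Fix N and an integer m with 1 ≤ m ≤ N/2, and parameters y₁,…,y_m ∈ ℂ with y_i·y_{N+1−i}... Define A ∈ End(ℂ^N) by A = ∑_{i=1}^m q^{−m}(1−q^{−N+2m}) e_ii + ∑_{m<i≤N−m} q^{−m} e_ii + ∑ over indices i with i ≤ m or i ≥ N+1−m of y_i e_{i,N+1−i}, where y_i y_{N+1−i} = q^{−N}. Then A satisfies the numerical reflection equation S A₂ S A₂ = A₂ S A₂ S, where S = P∘R with R the standard type A R-matrix on ℂ^N⊗ℂ^N. -/

import Mathlib

open Matrix

/-- The standard type A R-matrix on `ℂ^N ⊗ ℂ^N`. -/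
noncomputable def Rmat (N : ℕ) (q : ℂ) : Matrix (Fin N × Fin N) (Fin N × Fin N) ℂ :=
  Matrix.of fun p r =>
    (if p.1 = r.1 ∧ p.2 = r.2 then (if p.1 = p.2 then q else 1) else 0) +
    (if p.2 = r.1 ∧ p.1 = r.2 ∧ r.1 < p.1 then q - q⁻¹ else 0)

/-- `S = P ∘ R`. -/
noncomputable def Smat (N : ℕ) (q : ℂ) : Matrix (Fin N × Fin N) (Fin N × Fin N) ℂ :=
  Matrix.of fun p r => Rmat N q (p.2, p.1) r

/-- The quantum point of type T2:
`A = ∑_{i≤m} q^{−m}(1−q^{−N+2m}) e_ii + ∑_{m<i≤N−m} q^{−m} e_ii + ∑_{i≤m ∨ i≥N+1−m} y_i e_{i,i'}`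
(written with 0-based indices, `i' = N+1−i` in 1-based indexing). -/
noncomputable def Amat (N m : ℕ) (q : ℂ) (y : Fin N → ℂ) : Matrix (Fin N) (Fin N) ℂ :=
  Matrix.of fun i j =>
    (if i = j then
        (if (i : ℕ) < m then q ^ (-(m : ℤ)) * (1 - q ^ (2 * (m : ℤ) - (N : ℤ)))
         else if (i : ℕ) + m < N then q ^ (-(m : ℤ)) else 0)
      else 0) +
    (if ((i : ℕ) < m ∨ N ≤ (i : ℕ) + m) ∧ (i : ℕ) + (j : ℕ) + 1 = N then y i else 0)

/-- `A₂ = 1 ⊗ A` on `ℂ^N ⊗ ℂ^N`. -/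
noncomputable def A2 (N m : ℕ) (q : ℂ) (y : Fin N → ℂ) :
    Matrix (Fin N × Fin N) (Fin N × Fin N) ℂ :=
  Matrix.of fun p r => (if p.1 = r.1 then (1 : ℂ) else 0) * Amat N m q y p.2 r.2


noncomputable def sOp (N : ℕ) (q : ℂ) (f : Fin N → Fin N → ℂ) (a b : Fin N) : ℂ :=
  (if a = b then q else 1) * f b a + (if a < b then q - q⁻¹ else 0) * f a b

noncomputable def dOp (N m : ℕ) (q : ℂ) (b : Fin N) : ℂ :=
  if (b : ℕ) < m then q ^ (-(m : ℤ)) * (1 - q ^ (2 * (m : ℤ) - (N : ℤ)))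
         else if (b : ℕ) + m < N then q ^ (-(m : ℤ)) else 0

noncomputable def wOp (N m : ℕ) (y : Fin N → ℂ) (b : Fin N) : ℂ :=
  if ((b : ℕ) < m ∨ N ≤ (b : ℕ) + m) then y b else 0

noncomputable def aOp (N m : ℕ) (q : ℂ) (y : Fin N → ℂ) (f : Fin N → Fin N → ℂ)
    (a b : Fin N) : ℂ :=
  dOp N m q b * f a b + wOp N m y b * f a (Fin.rev b)

lemma s_mulVec (N : ℕ) (q : ℂ) (f : Fin N × Fin N → ℂ) :
    Smat N q *ᵥ f = fun p => sOp N q (fun a b => f (a, b)) p.1 p.2 := by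
  funext p
  obtain ⟨a, b⟩ := p
  have h : ∀ x : Fin N × Fin N, Smat N q (a, b) x * f x =
      (if x = (b, a) then (if a = b then q else 1) * f (b, a) else 0) +
      (if x = (a, b) then (if a < b then q - q⁻¹ else 0) * f (a, b) else 0) := by
    rintro ⟨c, e⟩
    simp only [Smat, Rmat, Matrix.of_apply, Prod.mk.injEq]
    rw [add_mul]
    congr 1
    · by_cases h1 : c = b <;> by_cases h2 : e = a <;> grind
    · by_cases h1 : c = a <;> by_cases h2 : e = b <;> grind
  simp only [Matrix.mulVec, dotProduct, h, Finset.sum_add_distrib]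
  simp [sOp]

lemma a_mulVec (N m : ℕ) (q : ℂ) (y : Fin N → ℂ) (f : Fin N × Fin N → ℂ) :
    A2 N m q y *ᵥ f = fun p => aOp N m q y (fun a b => f (a, b)) p.1 p.2 := by
  funext p
  obtain ⟨a, b⟩ := p
  have h : ∀ x : Fin N × Fin N, A2 N m q y (a, b) x * f x =
      (if x = (a, b) then dOp N m q b * f (a, b) else 0) +
      (if x = (a, Fin.rev b) then wOp N m y b * f (a, Fin.rev b) else 0) := by
    rintro ⟨c, e⟩
    simp only [A2, Amat, Matrix.of_apply, Prod.mk.injEq]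
    have hr : ((b : ℕ) + (e : ℕ) + 1 = N) ↔ e = Fin.rev b := by
      rw [Fin.ext_iff, Fin.val_rev]; omega
    simp only [hr, mul_add, add_mul]
    unfold dOp wOp
    by_cases h0 : a = c
    · subst h0
      congr 1
      · by_cases h1 : b = e
        · subst h1; simp
        · simp [h1, Ne.symm h1]
      · by_cases h1 : e = Fin.rev b
        · subst h1; simp
        · simp [h1]
    · simp [h0, Ne.symm h0]
  simp only [Matrix.mulVec, dotProduct, h, Finset.sum_add_distrib]
  simp [aOp]

set_option maxHeartbeats 4000000 in
lemma op_eq (N m : ℕ) (q : ℂ) (hq : q ≠ 0)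
    (hm : 1 ≤ m) (hm2 : 2 * m ≤ N) (y : Fin N → ℂ)
    (hy : ∀ i j : Fin N, (i : ℕ) < m → (i : ℕ) + (j : ℕ) + 1 = N →
      y i * y j = q ^ (-(N : ℤ))) (f : Fin N → Fin N → ℂ) (a b : Fin N) :
    sOp N q (aOp N m q y (sOp N q (aOp N m q y f))) a b =
    aOp N m q y (sOp N q (aOp N m q y (sOp N q f))) a b := by
  obtain ⟨Q, hQ⟩ : ∃ Q, Q = q ^ (-(m : ℤ)) := ⟨_, rfl⟩
  obtain ⟨K, hK⟩ : ∃ K, K = q ^ ((m : ℤ) - N) := ⟨_, rfl⟩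
  obtain ⟨p, hp⟩ : ∃ p, p = q⁻¹ := ⟨_, rfl⟩
  have hqp : q * p = 1 := by rw [hp]; exact mul_inv_cancel₀ hq
  have hQK : q ^ (-(N : ℤ)) = Q * K := by
    rw [hQ, hK, ← zpow_add₀ hq]; congr 1; ring
  have hd : q ^ (-(m : ℤ)) * (1 - q ^ (2 * (m : ℤ) - (N : ℤ))) = Q - K := by
    rw [hQ, hK, mul_sub, mul_one, ← zpow_add₀ hq]; congr 2; ring
  -- class data
  have key : ∀ i : Fin N,
      ((i : ℕ) < m ∧ dOp N m q i = Q - K ∧ dOp N m q i.rev = 0 ∧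
        wOp N m y i * wOp N m y i.rev = Q * K) ∨
      (m ≤ (i : ℕ) ∧ (i : ℕ) + m < N ∧ dOp N m q i = Q ∧ dOp N m q i.rev = Q ∧
        wOp N m y i = 0 ∧ wOp N m y i.rev = 0) ∨
      (N ≤ (i : ℕ) + m ∧ dOp N m q i = 0 ∧ dOp N m q i.rev = Q - K ∧
        wOp N m y i * wOp N m y i.rev = Q * K) := by
    intro i
    have hv : (i.rev : ℕ) = N - (i + 1) := Fin.val_rev i
    have hi := i.2
    unfold dOp wOp
    rw [hd, ← hQ, ← hQK]
    rcases lt_or_ge (i : ℕ) m with h | h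
    · left
      have := hy i i.rev h (by omega)
      refine ⟨h, by rw [if_pos h], ?_, ?_⟩
      · rw [if_neg (by omega), if_neg (by omega)]
      · rw [if_pos (Or.inl h), if_pos (by omega), this]
    right
    rcases lt_or_ge ((i : ℕ) + m) N with h' | h'
    · left
      refine ⟨h, h', ?_, ?_, ?_, ?_⟩
      · rw [if_neg (by omega), if_pos h']
      · rw [if_neg (by omega), if_pos (by omega)]
      · rw [if_neg (by omega)]
      · rw [if_neg (by omega)]
    · right
      have := hy i.rev i (by omega) (by omega)
      refine ⟨h', ?_, ?_, ?_⟩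
      · rw [if_neg (by omega), if_neg (by omega)]
      · rw [if_pos (by omega)]
      · rw [if_pos (by omega), if_pos (by omega), mul_comm, this]
  have ka := key a
  have kb := key b
  have hva : (a.rev : ℕ) = N - (a + 1) := Fin.val_rev a
  have hvb : (b.rev : ℕ) = N - (b + 1) := Fin.val_rev b
  have hia := a.2
  have hib := b.2
  simp only [sOp, aOp, Fin.rev_rev, ← hp]
  clear key hQ hK hp hd hQK hy
  rcases lt_trichotomy (a : ℕ) b with h1 | h1 | h1
  case inr.inl =>
    obtain rfl : a = b := Fin.ext h1
    rcases ka with ⟨h2, e1, e2, e3⟩ | ⟨h2, h3, e1, e2, e3, e4⟩ | ⟨h2, e1, e2, e3⟩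
    all_goals
      simp only [Fin.ext_iff, Fin.lt_def, hva]
      split_ifs <;> first | (exfalso; omega) | grind
  all_goals
    by_cases h0 : a = b.rev
    · subst h0
      simp only [Fin.rev_rev] at ka ⊢
      rcases kb with ⟨h2, e1, e2, e3⟩ | ⟨h2, h3, e1, e2, e3, e4⟩ | ⟨h2, e1, e2, e3⟩
      all_goals
        simp only [Fin.ext_iff, Fin.lt_def, hvb] at h1 ⊢
        split_ifs <;> first | (exfalso; omega) | grind
    · rw [Fin.ext_iff] at h0
      have n1 : ¬ a = b := by rw [Fin.ext_iff]; omega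
      have n2 : ¬ b = a := by rw [Fin.ext_iff]; omega
      have n3 : ¬ a = b.rev := by rw [Fin.ext_iff]; omega
      have n4 : ¬ b.rev = a := by rw [Fin.ext_iff]; omega
      have n5 : ¬ b = a.rev := by rw [Fin.ext_iff]; omega
      have n6 : ¬ a.rev = b := by rw [Fin.ext_iff]; omega
      have n7 : ¬ a.rev = b.rev := by rw [Fin.ext_iff]; omega
      have n8 : ¬ b.rev = a.rev := by rw [Fin.ext_iff]; omega
      have m1 : (a < b) ↔ (a : ℕ) < b := Iff.rfl
      have m2 : (b < a) ↔ ¬ (a : ℕ) < b := by rw [Fin.lt_def]; omega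
      have m3 : (a.rev < b.rev) ↔ ¬ (a : ℕ) < b := by rw [Fin.lt_def]; omega
      have m4 : (b.rev < a.rev) ↔ (a : ℕ) < b := by rw [Fin.lt_def]; omega
      have m5 : (a < b.rev) ↔ (a : ℕ) < b.rev := Iff.rfl
      have m6 : (b.rev < a) ↔ ¬ (a : ℕ) < b.rev := by rw [Fin.lt_def]; omega
      have m7 : (b < a.rev) ↔ (a : ℕ) < b.rev := by rw [Fin.lt_def]; omega
      have m8 : (a.rev < b) ↔ ¬ (a : ℕ) < b.rev := by rw [Fin.lt_def]; omega
      simp only [n1, n2, n3, n4, n5, n6, n7, n8, m1, m2, m3, m4, m5, m6, m7, m8, if_false,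
        not_lt_of_gt h1, h1, not_true_eq_false, not_false_eq_true, if_true]
      clear n1 n2 n3 n4 n5 n6 n7 n8 m1 m2 m3 m4 m5 m6 m7 m8
      generalize dOp N m q a = da at *
      generalize dOp N m q b = db at *
      generalize dOp N m q a.rev = da' at *
      generalize dOp N m q b.rev = db' at *
      generalize wOp N m y a = wa at *
      generalize wOp N m y b = wb at *
      generalize wOp N m y a.rev = wa' at *
      generalize wOp N m y b.rev = wb' at *
      generalize f a b = f1
      generalize f b a = f2
      generalize f a.rev b = f3
      generalize f b.rev a = f4
      generalize f a b.rev = f5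
      generalize f b a.rev = f6
      generalize f a.rev b.rev = f7
      generalize f b.rev a.rev = f8
      rcases lt_or_gt_of_ne h0 with h0 | h0
      all_goals
        simp only [not_lt_of_gt h0, h0, not_true_eq_false, not_false_eq_true, if_true, if_false]
        rcases ka with ⟨h2, e1, e2, e3⟩ | ⟨h2, h3, e1, e2, e3, e4⟩ | ⟨h2, e1, e2, e3⟩ <;>
        rcases kb with ⟨h2', e1', e2', e3'⟩ | ⟨h2', h3', e1', e2', e3', e4'⟩ | ⟨h2', e1', e2', e3'⟩
        all_goals first
          | (exfalso; omega)
          | (clear h0 h1 h2 h2' hva hvb hia hib hm hm2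
             subst_vars
             simp only [zero_mul, add_zero, zero_add, one_mul, mul_zero]
             first
               | ring1
               | (revert e3 e3'; intro e3 e3'; linear_combination (q - p) * f2 * e3 - (q - p) * f2 * e3')
               | (revert e3; intro e3; linear_combination (q - p) * f2 * e3)
               | linear_combination - (q - p) * f2 * e3')

/-- The quantum point of type T2 satisfies the numerical reflection equation
`S A₂ S A₂ = A₂ S A₂ S`. -/
theorem reflection_equation_T2 (N m : ℕ) (q : ℂ) (hq : q ≠ 0)
    (hm : 1 ≤ m) (hm2 : 2 * m ≤ N) (y : Fin N → ℂ)
    (hy : ∀ i j : Fin N, (i : ℕ) < m → (i : ℕ) + (j : ℕ) + 1 = N →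
      y i * y j = q ^ (-(N : ℤ))) :
    Smat N q * A2 N m q y * Smat N q * A2 N m q y
      = A2 N m q y * Smat N q * A2 N m q y * Smat N q := by
  have hs := s_mulVec N q
  have ha := a_mulVec N m q y
  apply Matrix.toLin'.injective
  apply LinearMap.ext
  intro f
  simp only [Matrix.toLin'_apply, ← Matrix.mulVec_mulVec, hs, ha]
  funext p
  exact op_eq N m q hq hm hm2 y hy (fun a b => f (a, b)) p.1 p.2
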